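/- arXiv:2406.14063 — 5 statements merged into one kernel-verified Lean document; each statement's English description precedes it below -/
import Mathlib

section
/- Let Ω ⊂ ℝⁿ (n ≥ 3) be a bounded open set, let γ be a conductivity on the closure of Ω, and let Ψ be a C¹ diffeomorphism of the closure of Ω onto itself. Then for all C¹ functions u, v on the closure of Ω, one has the change-of-variables identity for the Dirichlet energy pairing: ∫_Ω ((Ψ_*γ)(y) ∇u(y)) · ∇v(y) dy = ∫_Ω (γ(x) ∇(u∘Ψ)(x)) · ∇(v∘Ψ)(x) dx. -/
open MeasureTheory Matrix Set Filter
open scoped Topology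

noncomputable section

/-- The gradient of a scalar function on `ℝⁿ`, as a vector of partial derivatives. -/
def grad {n : ℕ} (u : (Fin n → ℝ) → ℝ) (x : Fin n → ℝ) : Fin n → ℝ :=
  fun i => fderiv ℝ u x (Pi.single i 1)

/-- The Jacobian matrix `(DΨ)_{ij} = ∂Ψ_i/∂x_j` of a map `Ψ : ℝⁿ → ℝⁿ`. -/
def Jac {n : ℕ} (Ψ : (Fin n → ℝ) → (Fin n → ℝ)) (x : Fin n → ℝ) :
    Matrix (Fin n) (Fin n) ℝ :=
  Matrix.of fun i j => fderiv ℝ (fun y => Ψ y i) x (Pi.single j 1)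

/-- A conductivity on a set `s`: a continuous map from `s` to the positive-definite
symmetric real `n × n` matrices. -/
def IsConductivityOn {n : ℕ} (γ : (Fin n → ℝ) → Matrix (Fin n) (Fin n) ℝ)
    (s : Set (Fin n → ℝ)) : Prop :=
  (∀ i j, ContinuousOn (fun x => γ x i j) s) ∧ ∀ x ∈ s, (γ x).IsSymm ∧ (γ x).PosDef

/-- The pushforward conductivity `Ψ_*γ = ((DΨ · γ · (DΨ)ᵀ)/|det DΨ|) ∘ Ψ⁻¹`, where
`Φ` denotes the inverse of `Ψ`. -/
def pushforward {n : ℕ} (Ψ Φ : (Fin n → ℝ) → (Fin n → ℝ))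
    (γ : (Fin n → ℝ) → Matrix (Fin n) (Fin n) ℝ) (y : Fin n → ℝ) :
    Matrix (Fin n) (Fin n) ℝ :=
  |(Jac Ψ (Φ y)).det|⁻¹ • (Jac Ψ (Φ y) * γ (Φ y) * (Jac Ψ (Φ y))ᵀ)

/-- A `C^k` diffeomorphism of the closure of `Ω` onto itself (restricting to a
diffeomorphism of `Ω` onto itself). -/
structure DiffeoOn {n : ℕ} (k : ℕ∞) (Ω : Set (Fin n → ℝ)) where
  toFun : (Fin n → ℝ) → (Fin n → ℝ)
  invFun : (Fin n → ℝ) → (Fin n → ℝ)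
  contDiffOn_toFun : ContDiffOn ℝ k toFun (closure Ω)
  contDiffOn_invFun : ContDiffOn ℝ k invFun (closure Ω)
  maps_toFun : MapsTo toFun (closure Ω) (closure Ω)
  maps_invFun : MapsTo invFun (closure Ω) (closure Ω)
  left_inv : ∀ x ∈ closure Ω, invFun (toFun x) = x
  right_inv : ∀ y ∈ closure Ω, toFun (invFun y) = y
  image_eq : toFun '' Ω = Ω

/-- A smooth test function compactly supported in `Ω`. -/
def IsTestFun {n : ℕ} (Ω : Set (Fin n → ℝ)) (v : (Fin n → ℝ) → ℝ) : Prop :=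
  ContDiff ℝ (⊤ : ℕ∞) v ∧ HasCompactSupport v ∧ tsupport v ⊆ Ω

/-- The divergence `div F = ∑ᵢ ∂Fᵢ/∂xᵢ` of a vector field on `ℝⁿ`. -/
def diverg {n : ℕ} (F : (Fin n → ℝ) → (Fin n → ℝ)) (x : Fin n → ℝ) : ℝ :=
  ∑ i, fderiv ℝ (fun y => F y i) x (Pi.single i 1)

/-- The Jacobian matrix represents the Fréchet derivative in the standard basis. -/
theorem jac_eq_toMatrix' {n : ℕ} {Ψ : (Fin n → ℝ) → (Fin n → ℝ)} {x : Fin n → ℝ}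
    (hΨ : DifferentiableAt ℝ Ψ x) :
    Jac Ψ x = LinearMap.toMatrix' (fderiv ℝ Ψ x : (Fin n → ℝ) →ₗ[ℝ] (Fin n → ℝ)) := by
  ext i j
  rw [LinearMap.toMatrix'_apply]
  simp only [Jac, Matrix.of_apply, ContinuousLinearMap.coe_coe]
  rw [fderiv_apply hΨ]
  rfl

/-- The Jacobian determinant is the determinant of the Fréchet derivative. -/
theorem det_jac {n : ℕ} {Ψ : (Fin n → ℝ) → (Fin n → ℝ)} {x : Fin n → ℝ}
    (hΨ : DifferentiableAt ℝ Ψ x) : (Jac Ψ x).det = (fderiv ℝ Ψ x).det := by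
  rw [jac_eq_toMatrix' hΨ, LinearMap.det_toMatrix']

/-- The chain rule for the gradient of a composition. -/
theorem grad_comp {n : ℕ} {Ψ : (Fin n → ℝ) → (Fin n → ℝ)} {u : (Fin n → ℝ) → ℝ}
    {x : Fin n → ℝ} (hu : DifferentiableAt ℝ u (Ψ x)) (hΨ : DifferentiableAt ℝ Ψ x) :
    grad (u ∘ Ψ) x = (Jac Ψ x)ᵀ *ᵥ grad u (Ψ x) := by
  ext j
  simp only [grad, fderiv_comp x hu hΨ, ContinuousLinearMap.comp_apply]
  conv_lhs => rw [pi_eq_sum_univ' (fderiv ℝ Ψ x (Pi.single j 1)), map_sum]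
  simp only [Matrix.mulVec, dotProduct, Matrix.transpose_apply, jac_eq_toMatrix' hΨ,
    LinearMap.toMatrix'_apply, map_smul, smul_eq_mul]
  refine Finset.sum_congr rfl fun i _ => ?_
  congr 3

/-- A differentiable map with a differentiable local left inverse has nonzero Jacobian. -/
theorem det_fderiv_ne_zero_of_leftInverse {n : ℕ} {Ψ Φ : (Fin n → ℝ) → (Fin n → ℝ)}
    {x : Fin n → ℝ} (hΦ : DifferentiableAt ℝ Φ (Ψ x)) (hΨ : DifferentiableAt ℝ Ψ x)
    (h : Φ ∘ Ψ =ᶠ[𝓝 x] id) : (fderiv ℝ Ψ x).det ≠ 0 := by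
  have key : (fderiv ℝ Φ (Ψ x)).comp (fderiv ℝ Ψ x) = ContinuousLinearMap.id ℝ _ := by
    rw [← fderiv_comp x hΦ hΨ, h.fderiv_eq, fderiv_id]
  have hdet : (fderiv ℝ Φ (Ψ x)).det * (fderiv ℝ Ψ x).det = 1 := by
    have := congrArg (fun L : (Fin n → ℝ) →L[ℝ] (Fin n → ℝ) => LinearMap.det
      (L : (Fin n → ℝ) →ₗ[ℝ] (Fin n → ℝ))) key
    simpa using this
  exact right_ne_zero_of_mul_eq_one hdet

/-- Change of variables identity for the Dirichlet energy pairing: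
for a `C¹` diffeomorphism `Ψ` of the closure of a bounded open set `Ω ⊂ ℝⁿ` (`n ≥ 3`)
onto itself, a conductivity `γ` on the closure of `Ω`, and `C¹` functions `u, v` on
the closure of `Ω`,
`∫_Ω ((Ψ_*γ) ∇u) · ∇v dy = ∫_Ω (γ ∇(u∘Ψ)) · ∇(v∘Ψ) dx`. -/
theorem dirichlet_pairing_change_of_variables
    {n : ℕ} (hn : 3 ≤ n) (Ω : Set (Fin n → ℝ)) (hΩo : IsOpen Ω)
    (hΩb : Bornology.IsBounded Ω)
    (γ : (Fin n → ℝ) → Matrix (Fin n) (Fin n) ℝ)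
    (hγ : IsConductivityOn γ (closure Ω))
    (Ψ : DiffeoOn 1 Ω)
    (u v : (Fin n → ℝ) → ℝ)
    (hu : ContDiffOn ℝ 1 u (closure Ω)) (hv : ContDiffOn ℝ 1 v (closure Ω)) :
    ∫ y in Ω, (pushforward Ψ.toFun Ψ.invFun γ y).mulVec (grad u y) ⬝ᵥ grad v y
      = ∫ x in Ω, (γ x).mulVec (grad (u ∘ Ψ.toFun) x) ⬝ᵥ grad (v ∘ Ψ.toFun) x := by
  have diff {E : Type} [NormedAddCommGroup E] [NormedSpace ℝ E] {f : (Fin n → ℝ) → E}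
      (hf : ContDiffOn ℝ 1 f (closure Ω)) {x : Fin n → ℝ} (hx : x ∈ Ω) :
      DifferentiableAt ℝ f x :=
    (hf.differentiableOn one_ne_zero x (subset_closure hx)).differentiableAt
      (mem_of_superset (hΩo.mem_nhds hx) subset_closure)
  have hmaps : MapsTo Ψ.toFun Ω Ω := fun x hx =>
    Ψ.image_eq.subset (mem_image_of_mem _ hx)
  have hinj : InjOn Ψ.toFun Ω := fun x hx y hy hxy => by
    rw [← Ψ.left_inv x (subset_closure hx), hxy, Ψ.left_inv y (subset_closure hy)]
  have hchange := integral_image_eq_integral_abs_det_fderiv_smul volume hΩo.measurableSet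
    (fun x hx => (diff Ψ.contDiffOn_toFun hx).hasFDerivAt.hasFDerivWithinAt) hinj
    (fun y => (pushforward Ψ.toFun Ψ.invFun γ y).mulVec (grad u y) ⬝ᵥ grad v y)
  rw [Ψ.image_eq] at hchange
  rw [hchange]
  refine setIntegral_congr_fun hΩo.measurableSet fun x hx => ?_
  have hΨx := diff Ψ.contDiffOn_toFun hx
  have hdet : (fderiv ℝ Ψ.toFun x).det ≠ 0 :=
    det_fderiv_ne_zero_of_leftInverse (diff Ψ.contDiffOn_invFun (hmaps hx)) hΨx <| by
      filter_upwards [hΩo.mem_nhds hx] with y hy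
      exact Ψ.left_inv y (subset_closure hy)
  simp only [pushforward, Ψ.left_inv x (subset_closure hx), det_jac hΨx,
    grad_comp (diff hu (hmaps hx)) hΨx, grad_comp (diff hv (hmaps hx)) hΨx,
    Matrix.smul_mulVec, smul_dotProduct, smul_smul, mul_inv_cancel₀ (abs_ne_zero.mpr hdet),
    one_smul]
  rw [Matrix.dotProduct_mulVec, Matrix.vecMul_transpose, Matrix.mulVec_mulVec,
    Matrix.mulVec_mulVec, Matrix.mul_assoc]
end
end

section
/- Let Ω ⊂ ℝⁿ (n ≥ 3) be a bounded open set, let γ be a C¹ conductivity on Ω, let λ ∈ ℝ, let f : Ω → ℝ be continuous, and let c, v : Ω → ℝ be C² functions with c(x) > 0 for all x ∈ Ω. Assume that −div(c² γ ∇v) = λ v on Ω and that c satisfies the nonlinear equation div(γ ∇c) + λ ( c − 1/c + c f ) = 0 on Ω. Then −div(γ ∇(c v)) = λ (1 + f) (c v) on Ω. -/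
open MeasureTheory Matrix Set Filter
open scoped Topology

noncomputable section

theorem grad_mul {n : ℕ} {a b : (Fin n → ℝ) → ℝ} {x : Fin n → ℝ}
    (ha : DifferentiableAt ℝ a x) (hb : DifferentiableAt ℝ b x) :
    grad (fun y => a y * b y) x = a x • grad b x + b x • grad a x := by
  ext i
  simp [grad, fderiv_fun_mul ha hb]

theorem diverg_add {n : ℕ} {F G : (Fin n → ℝ) → (Fin n → ℝ)} {x : Fin n → ℝ}
    (hF : ∀ i, DifferentiableAt ℝ (fun y => F y i) x)
    (hG : ∀ i, DifferentiableAt ℝ (fun y => G y i) x) :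
    diverg (fun y => F y + G y) x = diverg F x + diverg G x := by
  simp only [diverg, Pi.add_apply, ← Finset.sum_add_distrib]
  refine Finset.sum_congr rfl fun i _ => ?_
  simp [fderiv_fun_add (hF i) (hG i)]

theorem diverg_smul {n : ℕ} {a : (Fin n → ℝ) → ℝ} {F : (Fin n → ℝ) → (Fin n → ℝ)}
    {x : Fin n → ℝ} (ha : DifferentiableAt ℝ a x)
    (hF : ∀ i, DifferentiableAt ℝ (fun y => F y i) x) :
    diverg (fun y => a y • F y) x = a x * diverg F x + grad a x ⬝ᵥ F x := by
  simp only [diverg, grad, dotProduct, Pi.smul_apply, smul_eq_mul, Finset.mul_sum,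
    ← Finset.sum_add_distrib]
  refine Finset.sum_congr rfl fun i _ => ?_
  simp [fderiv_fun_mul ha (hF i), mul_comm]

theorem diverg_congr {n : ℕ} {F G : (Fin n → ℝ) → (Fin n → ℝ)} {x : Fin n → ℝ}
    (h : F =ᶠ[𝓝 x] G) : diverg F x = diverg G x := by
  refine Finset.sum_congr rfl fun i _ => ?_
  rw [Filter.EventuallyEq.fderiv_eq (h.mono fun y hy => congrFun hy i)]

theorem differentiableAt_mulVec_grad {n : ℕ} {γ : (Fin n → ℝ) → Matrix (Fin n) (Fin n) ℝ}
    {u : (Fin n → ℝ) → ℝ} {x : Fin n → ℝ}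
    (hγ : ∀ i j, DifferentiableAt ℝ (fun y => γ y i j) x) (hu : ContDiffAt ℝ 2 u x) (i : Fin n) :
    DifferentiableAt ℝ (fun y => (γ y).mulVec (grad u y) i) x := by
  have hdu : DifferentiableAt ℝ (fderiv ℝ u) x :=
    (hu.fderiv_right (m := 1) (by norm_num)).differentiableAt (by norm_num)
  simp only [mulVec, dotProduct, grad]
  exact DifferentiableAt.fun_sum fun j _ =>
    (hγ i j).mul (hdu.clm_apply (differentiableAt_const _))

theorem dotProduct_mulVec_comm_of_isSymm {n : ℕ} {A : Matrix (Fin n) (Fin n) ℝ}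
    (hA : A.IsSymm) (p q : Fin n → ℝ) : p ⬝ᵥ A.mulVec q = q ⬝ᵥ A.mulVec p := by
  rw [dotProduct_mulVec, ← mulVec_transpose, hA.eq, dotProduct_comm]

/-- If `−div(c²γ∇v) = λv` on `Ω` and `c > 0` satisfies the nonlinear
equation `div(γ∇c) + λ(c − 1/c + cf) = 0` on `Ω`, then
`−div(γ∇(cv)) = λ(1+f)(cv)` on `Ω`. -/
theorem conformal_rescaling_equation
    {n : ℕ} (hn : 3 ≤ n) (Ω : Set (Fin n → ℝ)) (hΩo : IsOpen Ω)
    (hΩb : Bornology.IsBounded Ω)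
    (γ : (Fin n → ℝ) → Matrix (Fin n) (Fin n) ℝ)
    (hγ : ∀ x ∈ Ω, (γ x).IsSymm ∧ (γ x).PosDef)
    (hγC1 : ∀ i j, ContDiffOn ℝ 1 (fun x => γ x i j) Ω)
    (lam : ℝ) (f : (Fin n → ℝ) → ℝ) (hf : ContinuousOn f Ω)
    (c v : (Fin n → ℝ) → ℝ)
    (hc : ContDiffOn ℝ 2 c Ω) (hv : ContDiffOn ℝ 2 v Ω)
    (hcpos : ∀ x ∈ Ω, 0 < c x)
    (hveq : ∀ x ∈ Ω,
      -diverg (fun y => (c y ^ 2) • (γ y).mulVec (grad v y)) x = lam * v x)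
    (hceq : ∀ x ∈ Ω,
      diverg (fun y => (γ y).mulVec (grad c y)) x
        + lam * (c x - 1 / c x + c x * f x) = 0) :
    ∀ x ∈ Ω,
      -diverg (fun y => (γ y).mulVec (grad (fun z => c z * v z) y)) x
        = lam * (1 + f x) * (c x * v x) := by
  intro x hx
  have hxΩ : Ω ∈ 𝓝 x := hΩo.mem_nhds hx
  have hcx : ContDiffAt ℝ 2 c x := hc.contDiffAt hxΩ
  have hvx : ContDiffAt ℝ 2 v x := hv.contDiffAt hxΩ
  have hcd : DifferentiableAt ℝ c x := hcx.differentiableAt (by norm_num)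
  have hvd : DifferentiableAt ℝ v x := hvx.differentiableAt (by norm_num)
  have hγd : ∀ i j, DifferentiableAt ℝ (fun y => γ y i j) x := fun i j =>
    ((hγC1 i j).contDiffAt hxΩ).differentiableAt (by norm_num)
  have hG := differentiableAt_mulVec_grad hγd hvx
  have hH := differentiableAt_mulVec_grad hγd hcx
  have hcG : ∀ i, DifferentiableAt ℝ (fun y => (c y • (γ y).mulVec (grad v y)) i) x :=
    fun i => hcd.mul (hG i)
  have hvH : ∀ i, DifferentiableAt ℝ (fun y => (v y • (γ y).mulVec (grad c y)) i) x :=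
    fun i => hvd.mul (hH i)
  have hsplit : (fun y => (γ y).mulVec (grad (fun z => c z * v z) y)) =ᶠ[𝓝 x]
      fun y => c y • (γ y).mulVec (grad v y) + v y • (γ y).mulVec (grad c y) := by
    filter_upwards [hxΩ] with y hy
    have hy' := hΩo.mem_nhds hy
    rw [grad_mul ((hc.contDiffAt hy').differentiableAt (by norm_num))
      ((hv.contDiffAt hy').differentiableAt (by norm_num)), mulVec_add, mulVec_smul, mulVec_smul]
  have hv' := hveq x hx
  have hc' := hceq x hx
  simp only [pow_two, mul_smul] at hv'
  rw [diverg_smul hcd hcG, diverg_smul hcd hG, dotProduct_smul, smul_eq_mul] at hv'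
  rw [diverg_congr hsplit, diverg_add hcG hvH, diverg_smul hcd hG, diverg_smul hvd hH,
    dotProduct_mulVec_comm_of_isSymm (hγ x hx).1 (grad v x) (grad c x)]
  have hne : c x ≠ 0 := (hcpos x hx).ne'
  have hinv : c x * (1 / c x) = 1 := mul_one_div_cancel hne
  apply mul_left_cancel₀ hne
  linear_combination hv' - c x * v x * hc' - lam * v x * hinv
end
end

section
/- Let Ω ⊂ ℝⁿ (n ≥ 3) be a bounded open set and let γ be a conductivity on the closure of Ω. Let W = { Q_γ(u) : u ∈ X_∞ } ⊂ ℝ, where Q_γ(u) = ∫_Ω (γ(x)∇u(x))·∇u(x) dx. Then W is convex: for all a, b ∈ W and all t ∈ [0,1], the number t a + (1−t) b belongs to W. -/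
open MeasureTheory Matrix Set Filter
open scoped Topology

noncomputable section

/-- `X_∞`: smooth compactly supported functions in `Ω`, `L²`-normalized and with
zero mean. -/
def MemXinf {n : ℕ} (Ω : Set (Fin n → ℝ)) (u : (Fin n → ℝ) → ℝ) : Prop :=
  ContDiff ℝ (⊤ : ℕ∞) u ∧ HasCompactSupport u ∧ tsupport u ⊆ Ω ∧
    (∫ x in Ω, (u x) ^ 2) = 1 ∧ (∫ x in Ω, u x) = 0

/-- The Dirichlet quadratic form `Q_γ(u) = ∫_Ω (γ∇u)·∇u dx`. -/
def Qform {n : ℕ} (Ω : Set (Fin n → ℝ)) (γ : (Fin n → ℝ) → Matrix (Fin n) (Fin n) ℝ)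
    (u : (Fin n → ℝ) → ℝ) : ℝ :=
  ∫ x in Ω, (γ x).mulVec (grad u x) ⬝ᵥ grad u x

theorem grad_linearCombination {n : ℕ} {u v : (Fin n → ℝ) → ℝ} (hu : ContDiff ℝ (⊤ : ℕ∞) u)
    (hv : ContDiff ℝ (⊤ : ℕ∞) v) (α β : ℝ) (x : Fin n → ℝ) :
    grad (fun y => α * u y + β * v y) x = α • grad u x + β • grad v x := by
  have hu' : DifferentiableAt ℝ u x := hu.differentiable (by simp) x
  have hv' : DifferentiableAt ℝ v x := hv.differentiable (by simp) x
  ext i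
  simp [grad, fderiv_fun_add (hu'.const_mul α) (hv'.const_mul β), fderiv_const_mul hu',
    fderiv_const_mul hv']

theorem continuous_grad {n : ℕ} {u : (Fin n → ℝ) → ℝ} (hu : ContDiff ℝ (⊤ : ℕ∞) u) :
    Continuous (grad u) :=
  continuous_pi fun _ => (hu.continuous_fderiv (by simp)).clm_apply continuous_const

theorem integrableOn_of_continuousOn_closure {n : ℕ} {Ω : Set (Fin n → ℝ)}
    (hΩ : Bornology.IsBounded Ω) {f : (Fin n → ℝ) → ℝ} (hf : ContinuousOn f (closure Ω)) :
    IntegrableOn f Ω :=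
  (hf.integrableOn_compact hΩ.isCompact_closure).mono_set subset_closure

theorem integrableOn_mulVec_grad_dotProduct {n : ℕ} {Ω : Set (Fin n → ℝ)}
    (hΩ : Bornology.IsBounded Ω) {γ : (Fin n → ℝ) → Matrix (Fin n) (Fin n) ℝ}
    (hγ : IsConductivityOn γ (closure Ω)) {u v : (Fin n → ℝ) → ℝ}
    (hu : ContDiff ℝ (⊤ : ℕ∞) u) (hv : ContDiff ℝ (⊤ : ℕ∞) v) :
    IntegrableOn (fun x => (γ x).mulVec (grad u x) ⬝ᵥ grad v x) Ω := by
  have hgu := continuous_pi_iff.1 (continuous_grad hu)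
  have hgv := continuous_pi_iff.1 (continuous_grad hv)
  refine integrableOn_of_continuousOn_closure hΩ ?_
  simp only [dotProduct, mulVec]
  exact continuousOn_finsetSum _ fun i _ => (continuousOn_finsetSum _ fun j _ =>
    (hγ.1 i j).mul (hgu j).continuousOn).mul (hgv i).continuousOn

/-- The Dirichlet form restricted to the span of two smooth functions is a binary
quadratic form. -/
theorem exists_Qform_linearCombination {n : ℕ} {Ω : Set (Fin n → ℝ)}
    (hΩ : Bornology.IsBounded Ω) {γ : (Fin n → ℝ) → Matrix (Fin n) (Fin n) ℝ}
    (hγ : IsConductivityOn γ (closure Ω)) {u v : (Fin n → ℝ) → ℝ}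
    (hu : ContDiff ℝ (⊤ : ℕ∞) u) (hv : ContDiff ℝ (⊤ : ℕ∞) v) :
    ∃ c : ℝ, ∀ α β : ℝ, Qform Ω γ (fun y => α * u y + β * v y) =
      α ^ 2 * Qform Ω γ u + α * β * c + β ^ 2 * Qform Ω γ v := by
  have huu := integrableOn_mulVec_grad_dotProduct hΩ hγ hu hu
  have huv := integrableOn_mulVec_grad_dotProduct hΩ hγ hu hv
  have hvu := integrableOn_mulVec_grad_dotProduct hΩ hγ hv hu
  have hvv := integrableOn_mulVec_grad_dotProduct hΩ hγ hv hv
  have hcross : IntegrableOn (fun x => (γ x).mulVec (grad u x) ⬝ᵥ grad v x +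
    (γ x).mulVec (grad v x) ⬝ᵥ grad u x) Ω := huv.add hvu
  refine ⟨∫ x in Ω, ((γ x).mulVec (grad u x) ⬝ᵥ grad v x +
    (γ x).mulVec (grad v x) ⬝ᵥ grad u x), fun α β => ?_⟩
  unfold Qform
  rw [← integral_const_mul, ← integral_const_mul, ← integral_const_mul,
    ← integral_add (huu.const_mul _) (hcross.const_mul _),
    ← integral_add ((huu.const_mul _).fun_add (hcross.const_mul _)) (hvv.const_mul _)]
  congr 1 with x
  simp only [grad_linearCombination hu hv, mulVec_add, mulVec_smul, add_dotProduct,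
    dotProduct_add, smul_dotProduct, dotProduct_smul, smul_eq_mul]
  ring

theorem integral_sq_linearCombination {n : ℕ} {Ω : Set (Fin n → ℝ)}
    (hΩ : Bornology.IsBounded Ω) {u v : (Fin n → ℝ) → ℝ}
    (hu : Continuous u) (hv : Continuous v) (α β : ℝ) :
    ∫ x in Ω, (α * u x + β * v x) ^ 2 = α ^ 2 * (∫ x in Ω, u x ^ 2) +
      2 * α * β * (∫ x in Ω, u x * v x) + β ^ 2 * ∫ x in Ω, v x ^ 2 := by
  have huu : IntegrableOn (fun x => u x ^ 2) Ω :=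
    integrableOn_of_continuousOn_closure hΩ (hu.pow 2).continuousOn
  have huv : IntegrableOn (fun x => u x * v x) Ω :=
    integrableOn_of_continuousOn_closure hΩ (hu.mul hv).continuousOn
  have hvv : IntegrableOn (fun x => v x ^ 2) Ω :=
    integrableOn_of_continuousOn_closure hΩ (hv.pow 2).continuousOn
  rw [← integral_const_mul, ← integral_const_mul, ← integral_const_mul,
    ← integral_add (huu.const_mul _) (huv.const_mul _),
    ← integral_add ((huu.const_mul _).fun_add (huv.const_mul _)) (hvv.const_mul _)]
  congr 1 with x
  ring

theorem MemXinf.linearCombination {n : ℕ} {Ω : Set (Fin n → ℝ)}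
    (hΩ : Bornology.IsBounded Ω) {u v : (Fin n → ℝ) → ℝ} (hu : MemXinf Ω u)
    (hv : MemXinf Ω v) {α β : ℝ}
    (h : α ^ 2 + 2 * α * β * (∫ x in Ω, u x * v x) + β ^ 2 = 1) :
    MemXinf Ω (fun y => α * u y + β * v y) := by
  obtain ⟨hu, huc, hus, hu1, hu0⟩ := hu
  obtain ⟨hv, hvc, hvs, hv1, hv0⟩ := hv
  refine ⟨(contDiff_const.mul hu).add (contDiff_const.mul hv),
    huc.mul_left.add hvc.mul_left, ?_, ?_, ?_⟩
  · refine (tsupport_add _ _).trans (union_subset ?_ ?_)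
    · exact (tsupport_mul_subset_right (f := fun _ => α)).trans hus
    · exact (tsupport_mul_subset_right (f := fun _ => β)).trans hvs
  · rw [integral_sq_linearCombination hΩ hu.continuous hv.continuous, hu1, hv1]
    simpa using h
  · have hui := integrableOn_of_continuousOn_closure hΩ hu.continuous.continuousOn
    have hvi := integrableOn_of_continuousOn_closure hΩ hv.continuous.continuousOn
    rw [integral_add (hui.const_mul _) (hvi.const_mul _), integral_const_mul,
      integral_const_mul, hu0, hv0]
    simp

/-- The constrained numerical range
`W = { Q_γ(u) : u ∈ X_∞ }` is a convex subset of `ℝ`. -/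
theorem numericalRange_convex
    {n : ℕ} (hn : 3 ≤ n) (Ω : Set (Fin n → ℝ)) (hΩo : IsOpen Ω)
    (hΩb : Bornology.IsBounded Ω)
    (γ : (Fin n → ℝ) → Matrix (Fin n) (Fin n) ℝ)
    (hγ : IsConductivityOn γ (closure Ω)) :
    ∀ a ∈ {r : ℝ | ∃ u, MemXinf Ω u ∧ Qform Ω γ u = r},
    ∀ b ∈ {r : ℝ | ∃ u, MemXinf Ω u ∧ Qform Ω γ u = r},
    ∀ t ∈ Set.Icc (0 : ℝ) 1,
      t * a + (1 - t) * b ∈ {r : ℝ | ∃ u, MemXinf Ω u ∧ Qform Ω γ u = r} := by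
  rintro a ⟨u, hu, rfl⟩ b ⟨v, hv, rfl⟩ t ⟨ht0, ht1⟩
  obtain ⟨c, hc⟩ := exists_Qform_linearCombination hΩb hγ hu.1 hv.1
  set B := ∫ x in Ω, u x * v x with hB
  obtain ⟨σ, hσ, hσB⟩ : ∃ σ : ℝ, σ ^ 2 = 1 ∧ 0 ≤ σ * B := by
    rcases le_total 0 B with h | h
    · exact ⟨1, by norm_num, by simpa using h⟩
    · exact ⟨-1, by norm_num, by simpa using h⟩
  set N : ℝ → ℝ := fun s => (1 - s) ^ 2 + 2 * (1 - s) * (s * σ) * B + (s * σ) ^ 2 with hN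
  set P : ℝ → ℝ := fun s => (1 - s) ^ 2 * Qform Ω γ u + (1 - s) * (s * σ) * c +
    (s * σ) ^ 2 * Qform Ω γ v with hP
  have hNpos : ∀ s ∈ Icc (0 : ℝ) 1, 0 < N s := by
    rintro s ⟨h0, h1⟩
    have h2 : 0 ≤ (1 - s) * s * (σ * B) :=
      mul_nonneg (mul_nonneg (sub_nonneg.2 h1) h0) hσB
    have h3 : N s = (1 - s) ^ 2 + 2 * ((1 - s) * s * (σ * B)) + s ^ 2 := by
      simp only [hN, mul_pow, hσ]
      ring
    rw [h3]
    nlinarith [sq_nonneg (1 - 2 * s)]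
  have hcont : ContinuousOn (fun s => P s / N s) (uIcc 0 1) := by
    rw [uIcc_of_le zero_le_one]
    exact ContinuousOn.div (by fun_prop) (by fun_prop) fun s hs => (hNpos s hs).ne'
  have hmem : t * Qform Ω γ u + (1 - t) * Qform Ω γ v ∈ uIcc (P 0 / N 0) (P 1 / N 1) := by
    have h0 : P 0 / N 0 = Qform Ω γ u := by simp [hP, hN]
    have h1 : P 1 / N 1 = Qform Ω γ v := by simp [hP, hN, hσ]
    rw [h0, h1, ← segment_eq_uIcc]
    exact ⟨t, 1 - t, ht0, sub_nonneg.2 ht1, by ring, rfl⟩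
  obtain ⟨s, hs, hst⟩ := intermediate_value_uIcc hcont hmem
  rw [uIcc_of_le zero_le_one] at hs
  have hpos := hNpos s hs
  have hsq : √(N s) ^ 2 = N s := Real.sq_sqrt hpos.le
  refine ⟨fun y => (1 - s) / √(N s) * u y + s * σ / √(N s) * v y,
    hu.linearCombination hΩb hv ?_, ?_⟩
  · rw [← hB]
    have : ((1 - s) / √(N s)) ^ 2 + 2 * ((1 - s) / √(N s)) * (s * σ / √(N s)) * B +
        (s * σ / √(N s)) ^ 2 = N s / √(N s) ^ 2 := by
      simp only [hN]
      ring
    rw [this, hsq, div_self hpos.ne']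
  · rw [hc, ← hst]
    change _ = P s / N s
    have : P s / N s = P s / √(N s) ^ 2 := by rw [hsq]
    rw [this]
    simp only [hP]
    ring
end
end

section
/- Let V be a real normed vector space, let B : V × V → ℝ be a continuous symmetric bilinear form, and let M be a linear subspace of V. Then the constrained numerical range { B(u, u) : u ∈ M, ‖u‖ = 1 } is a convex subset of ℝ: for all a, b in this set and all t ∈ [0,1], the number t a + (1−t) b also belongs to this set. -/
open Set

/-- The constrained numerical range `{ B(u,u) : u ∈ M, ‖u‖ = 1 }` of a
continuous symmetric bilinear form `B` on a real normed vector space `V`, restricted to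
a linear subspace `M`, is a convex subset of `ℝ`. -/
theorem constrained_numericalRange_convex
    {V : Type*} [NormedAddCommGroup V] [NormedSpace ℝ V]
    (B : V →L[ℝ] V →L[ℝ] ℝ) (hB : ∀ u v : V, B u v = B v u)
    (M : Submodule ℝ V) :
    ∀ a ∈ {r : ℝ | ∃ u, u ∈ M ∧ ‖u‖ = 1 ∧ B u u = r},
    ∀ b ∈ {r : ℝ | ∃ u, u ∈ M ∧ ‖u‖ = 1 ∧ B u u = r},
    ∀ t ∈ Set.Icc (0 : ℝ) 1,
      t * a + (1 - t) * b ∈ {r : ℝ | ∃ u, u ∈ M ∧ ‖u‖ = 1 ∧ B u u = r} := by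
  rintro a ⟨u, hu, hu1, rfl⟩ b ⟨v, hv, hv1, rfl⟩ t ⟨ht0, ht1⟩
  by_cases huv : u = -v
  · refine ⟨u, hu, hu1, ?_⟩
    subst huv
    simp only [map_neg, neg_apply, neg_neg]
    ring
  let w : ℝ → V := fun s => s • u + (1 - s) • v
  have hw : ∀ s ∈ Icc (0 : ℝ) 1, ‖w s‖ ≠ 0 := by
    rintro s ⟨hs0, hs1⟩ h
    have h0 : s • u = -((1 - s) • v) := eq_neg_of_add_eq_zero_left (norm_eq_zero.mp h)
    have hn := congrArg norm h0
    rw [norm_neg, norm_smul, norm_smul, hu1, hv1, Real.norm_of_nonneg hs0,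
      Real.norm_of_nonneg (sub_nonneg.mpr hs1), mul_one, mul_one] at hn
    rw [← hn, ← smul_neg] at h0
    exact huv (smul_right_injective V (by linarith : s ≠ 0) h0)
  have hwc : Continuous w := by fun_prop
  have hf : ContinuousOn (fun s => B (w s) (w s) / ‖w s‖ ^ 2) (Icc 0 1) :=
    ContinuousOn.div (by fun_prop) (by fun_prop) fun s hs => pow_ne_zero 2 (hw s hs)
  have himage := (isPreconnected_Icc.image _ hf).ordConnected.convex (𝕜 := ℝ)
  have ha : B u u ∈ (fun s => B (w s) (w s) / ‖w s‖ ^ 2) '' Icc (0 : ℝ) 1 :=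
    ⟨1, by simp, by simp [w, hu1]⟩
  have hb : B v v ∈ (fun s => B (w s) (w s) / ‖w s‖ ^ 2) '' Icc (0 : ℝ) 1 :=
    ⟨0, by simp, by simp [w, hv1]⟩
  obtain ⟨s, hs, hsw⟩ := himage ha hb ht0 (sub_nonneg.mpr ht1) (by ring)
  refine ⟨‖w s‖⁻¹ • w s, M.smul_mem _ (M.add_mem (M.smul_mem _ hu) (M.smul_mem _ hv)), ?_, ?_⟩
  · rw [norm_smul, norm_inv, norm_norm, inv_mul_cancel₀ (hw s hs)]
  · simp only [smul_eq_mul] at hsw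
    rw [← hsw]
    simp only [map_smul, smul_apply, smul_eq_mul]
    have := hw s hs
    field_simp
end

section
/- Let Ω ⊂ ℝⁿ (n ≥ 3) be a bounded open set, let γ be a conductivity on the closure of Ω, let u : Ω → ℝ be a nonzero smooth compactly supported function with ∫_Ω u dx = 0 and ∫_Ω u² dx = 1, let α > 0, and for small ε > 0 set c_ε(x) = (1 + ε u(x))^α and λ_ε = ( ∫_Ω (γ∇c_ε)·∇c_ε / c_ε² dx ) / ( ∫_Ω ( c_ε^{−2} − 1 ) dx ). Then λ_ε is well defined for all sufficiently small ε > 0 (the denominator is nonzero) and λ_ε tends to (α/(2α+1)) ∫_Ω (γ∇u)·∇u dx as ε tends to 0 from the right. -/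
open MeasureTheory Matrix Set Filter
open scoped Topology

noncomputable section

/-- Second-order expansion of `(1 + t) ^ p` at `t = 0`, in quotient form. -/
theorem tendsto_one_add_rpow_sub_taylor_div_sq (p : ℝ) :
    Tendsto (fun t : ℝ => ((1 + t) ^ p - 1 - p * t) / t ^ 2) (𝓝[≠] 0)
      (𝓝 (p * (p - 1) / 2)) := by
  have hpow : ∀ (q t : ℝ), -1 < t →
      HasDerivAt (fun t : ℝ => (1 + t) ^ q) (q * (1 + t) ^ (q - 1)) t := by
    intro q t ht
    have h := ((hasDerivAt_id t).const_add 1).rpow_const (p := q)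
      (Or.inl (by simp only [id]; linarith))
    simpa using h
  have hnear : ∀ᶠ t : ℝ in 𝓝[≠] 0, -1 < t :=
    nhdsWithin_le_nhds (lt_mem_nhds (by norm_num))
  have hcont : ContinuousAt (fun t : ℝ => (1 + t) ^ p - 1 - p * t) 0 :=
    ((hpow p 0 (by norm_num)).continuousAt.sub continuousAt_const).sub (by fun_prop)
  have hslope := hasDerivAt_iff_tendsto_slope.mp (hpow (p - 1) 0 (by norm_num))
  refine HasDerivAt.lhopital_zero_nhdsNE
    (f' := fun t => p * (1 + t) ^ (p - 1) - p) (g' := fun t => 2 * t) ?_ ?_ ?_ ?_ ?_ ?_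
  · filter_upwards [hnear] with t ht
    simpa using ((hpow p t ht).sub_const 1).fun_sub ((hasDerivAt_id t).const_mul p)
  · filter_upwards with t
    simpa using hasDerivAt_pow 2 t
  · filter_upwards [self_mem_nhdsWithin] with t ht
    exact mul_ne_zero two_ne_zero ht
  · simpa using hcont.tendsto.mono_left nhdsWithin_le_nhds
  · have h : Tendsto (fun t : ℝ => t ^ 2) (𝓝 0) (𝓝 (0 ^ 2)) := (continuous_pow 2).tendsto 0
    simpa using h.mono_left nhdsWithin_le_nhds
  · have h := hslope.const_mul (p / 2)
    have hval : p / 2 * ((p - 1) * (1 + 0) ^ (p - 1 - 1)) = p * (p - 1) / 2 := by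
      simp; ring
    rw [hval] at h
    refine h.congr' ?_
    filter_upwards [self_mem_nhdsWithin] with t ht
    have ht0 : t ≠ 0 := ht
    simp only [slope_def_field, add_zero, Real.one_rpow, sub_zero]
    field_simp

/-- Second-order expansion of `(1 + t) ^ p` at `t = 0`, with an explicit quadratic error. -/
theorem eventually_abs_one_add_rpow_sub_taylor_le (p : ℝ) {δ : ℝ} (hδ : 0 < δ) :
    ∀ᶠ t : ℝ in 𝓝 0,
      |(1 + t) ^ p - 1 - p * t - p * (p - 1) / 2 * t ^ 2| ≤ δ * t ^ 2 := by
  have h := (Metric.tendsto_nhds.mp (tendsto_one_add_rpow_sub_taylor_div_sq p)) δ hδ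
  rw [eventually_nhdsWithin_iff] at h
  filter_upwards [h] with t ht
  rcases eq_or_ne t 0 with rfl | ht0
  · simp
  have h2 : 0 < t ^ 2 := by positivity
  have h1 := (ht ht0).le
  rw [Real.dist_eq] at h1
  calc |(1 + t) ^ p - 1 - p * t - p * (p - 1) / 2 * t ^ 2|
      = |((1 + t) ^ p - 1 - p * t) / t ^ 2 - p * (p - 1) / 2| * t ^ 2 := by
        nth_rewrite 3 [← abs_of_pos h2]
        rw [← abs_mul]
        congr 1
        field_simp
    _ ≤ δ * t ^ 2 := by gcongr

/-- For a bounded function `v`, any property holding near `0` holds for `ε * v x` uniformly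
in `x` when `ε` is small. -/
theorem eventually_forall_mul_of_bounded {X : Type*} {v : X → ℝ} {M : ℝ}
    (hv : ∀ x, |v x| ≤ M) {P : ℝ → Prop} (hP : ∀ᶠ t in 𝓝 (0 : ℝ), P t) :
    ∀ᶠ ε in 𝓝 (0 : ℝ), ∀ x, P (ε * v x) := by
  obtain ⟨r, hr, hball⟩ := Metric.eventually_nhds_iff.mp hP
  have hlim : Tendsto (fun ε : ℝ => |ε| * M) (𝓝 0) (𝓝 0) := by
    have h : Continuous fun ε : ℝ => |ε| * M := by fun_prop
    simpa using h.tendsto 0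
  filter_upwards [hlim (gt_mem_nhds hr)] with ε hε x
  refine hball ?_
  rw [Real.dist_eq, sub_zero, abs_mul]
  exact (mul_le_mul_of_nonneg_left (hv x) (abs_nonneg ε)).trans_lt hε

/-- If `v` has mean zero, then `∫ ((1 + ε v) ^ p - 1)` is asymptotic to
`ε² p (p - 1) / 2 ∫ v²`. -/
theorem tendsto_integral_one_add_rpow_sub_one_div_sq {X : Type*} [TopologicalSpace X]
    [MeasurableSpace X] [OpensMeasurableSpace X] {μ : Measure X} [IsFiniteMeasure μ]
    {v : X → ℝ} {M : ℝ} (hvc : Continuous v) (hv : ∀ x, |v x| ≤ M)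
    (hv0 : ∫ x, v x ∂μ = 0) (p : ℝ) :
    Tendsto (fun ε : ℝ => (∫ x, ((1 + ε * v x) ^ p - 1) ∂μ) / ε ^ 2) (𝓝[≠] 0)
      (𝓝 (p * (p - 1) / 2 * ∫ x, v x ^ 2 ∂μ)) := by
  have hvi : Integrable v μ :=
    .of_bound hvc.aestronglyMeasurable M (.of_forall hv)
  have hvi2 : Integrable (fun x => v x ^ 2) μ := by
    refine .of_bound (hvc.pow 2).aestronglyMeasurable (M ^ 2) (.of_forall fun x => ?_)
    rw [Real.norm_eq_abs, abs_pow]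
    exact pow_le_pow_left₀ (abs_nonneg _) (hv x) 2
  set I := ∫ x, v x ^ 2 ∂μ
  have hI : 0 ≤ I := integral_nonneg fun x => sq_nonneg _
  rw [Metric.tendsto_nhds]
  intro η hη
  set δ := η / (I + 1)
  have hδ : 0 < δ := by positivity
  have hδI : δ * I < η := by
    have h : δ * (I + 1) = η := div_mul_cancel₀ _ (by positivity)
    nlinarith
  have hpos := eventually_forall_mul_of_bounded hv
    (P := fun t => -1 < t) (lt_mem_nhds (by norm_num))
  have hexp := eventually_forall_mul_of_bounded hv
    (eventually_abs_one_add_rpow_sub_taylor_le p hδ)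
  filter_upwards [nhdsWithin_le_nhds hexp, nhdsWithin_le_nhds hpos,
    self_mem_nhdsWithin] with ε hε hε' hne
  have hε0 : 0 < ε ^ 2 := by
    have : ε ≠ 0 := hne
    positivity
  have hrc : Continuous fun x => (1 + ε * v x) ^ p :=
    (by fun_prop : Continuous fun x => 1 + ε * v x).rpow_const fun x =>
      Or.inl (by linarith [hε' x])
  have hlin : Integrable (fun x => p * (ε * v x)) μ := (hvi.const_mul ε).const_mul p
  have hquad : Integrable (fun x => p * (p - 1) / 2 * (ε * v x) ^ 2) μ := by
    simpa only [mul_pow] using (hvi2.const_mul (ε ^ 2)).const_mul (p * (p - 1) / 2)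
  have herr : Integrable (fun x => δ * (ε * v x) ^ 2) μ := by
    simpa only [mul_pow] using (hvi2.const_mul (ε ^ 2)).const_mul δ
  have hrem : Integrable (fun x =>
      (1 + ε * v x) ^ p - 1 - p * (ε * v x) - p * (p - 1) / 2 * (ε * v x) ^ 2) μ :=
    herr.mono' (by
      refine Continuous.aestronglyMeasurable ?_
      fun_prop) (.of_forall hε)
  have hsplit : ∫ x, ((1 + ε * v x) ^ p - 1) ∂μ =
      (∫ x, ((1 + ε * v x) ^ p - 1 - p * (ε * v x)
        - p * (p - 1) / 2 * (ε * v x) ^ 2) ∂μ) + p * (p - 1) / 2 * I * ε ^ 2 := by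
    have h1 : ∫ x, p * (ε * v x) ∂μ = 0 := by
      rw [integral_const_mul, integral_const_mul, hv0, mul_zero, mul_zero]
    have h2 : ∫ x, p * (p - 1) / 2 * (ε * v x) ^ 2 ∂μ = p * (p - 1) / 2 * I * ε ^ 2 := by
      simp only [mul_pow]
      rw [integral_const_mul, integral_const_mul]
      ring
    rw [← h2, ← integral_add hrem hquad, ← add_zero (∫ x, _ + _ ∂μ), ← h1,
      ← integral_add (hrem.fun_add hquad) hlin]
    refine integral_congr_ae (.of_forall fun x => ?_)
    ring
  have hbound : |∫ x, ((1 + ε * v x) ^ p - 1 - p * (ε * v x)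
      - p * (p - 1) / 2 * (ε * v x) ^ 2) ∂μ| ≤ δ * I * ε ^ 2 := by
    rw [← Real.norm_eq_abs]
    refine (norm_integral_le_of_norm_le herr (.of_forall fun x => ?_)).trans_eq ?_
    · exact hε x
    simp only [mul_pow]
    rw [integral_const_mul, integral_const_mul]
    ring
  rw [Real.dist_eq, hsplit, add_div, mul_div_cancel_right₀ _ hε0.ne', add_sub_cancel_right,
    abs_div, abs_of_pos hε0, div_lt_iff₀ hε0]
  exact hbound.trans_lt (mul_lt_mul_of_pos_right hδI hε0)

/-- The gradient of `(1 + ε u) ^ α` where `1 + ε u` is positive. -/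
theorem grad_one_add_mul_rpow {n : ℕ} {u : (Fin n → ℝ) → ℝ} {x : Fin n → ℝ}
    (hu : DifferentiableAt ℝ u x) {ε : ℝ} (α : ℝ) (hpos : 0 < 1 + ε * u x) :
    grad (fun y => (1 + ε * u y) ^ α) x =
      (α * (1 + ε * u x) ^ (α - 1) * ε) • grad u x := by
  have h := ((hu.hasFDerivAt.const_mul ε).const_add 1).rpow_const (p := α) (Or.inl hpos.ne')
  ext i
  simp only [grad, h.fderiv, Pi.smul_apply, _root_.smul_apply, smul_eq_mul]
  ring

/-- The integrand of the numerator of `λ_ε`. -/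
theorem energy_one_add_mul_rpow {n : ℕ} (A : Matrix (Fin n) (Fin n) ℝ)
    {u : (Fin n → ℝ) → ℝ} {x : Fin n → ℝ} (hu : DifferentiableAt ℝ u x) {ε : ℝ} (α : ℝ)
    (hpos : 0 < 1 + ε * u x) :
    (A.mulVec (grad (fun y => (1 + ε * u y) ^ α) x)
        ⬝ᵥ grad (fun y => (1 + ε * u y) ^ α) x) / ((1 + ε * u x) ^ α) ^ 2 =
      α ^ 2 * ε ^ 2 * ((A.mulVec (grad u x) ⬝ᵥ grad u x) / (1 + ε * u x) ^ 2) := by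
  rw [grad_one_add_mul_rpow hu α hpos, Matrix.mulVec_smul, smul_dotProduct, dotProduct_smul,
    Real.rpow_sub_one hpos.ne']
  have := (Real.rpow_pos_of_pos hpos α).ne'
  simp only [smul_eq_mul]
  field_simp

/-- The energy density of a smooth function is integrable on a bounded set. -/
theorem integrableOn_energy {n : ℕ} {Ω : Set (Fin n → ℝ)} (hΩb : Bornology.IsBounded Ω)
    {γ : (Fin n → ℝ) → Matrix (Fin n) (Fin n) ℝ} (hγ : IsConductivityOn γ (closure Ω))
    {u : (Fin n → ℝ) → ℝ} (hu : ContDiff ℝ 1 u) :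
    IntegrableOn (fun x => (γ x).mulVec (grad u x) ⬝ᵥ grad u x) Ω := by
  have hg : ∀ i, Continuous fun x => grad u x i := fun i =>
    (hu.continuous_fderiv one_ne_zero).clm_apply continuous_const
  refine (ContinuousOn.integrableOn_compact hΩb.isCompact_closure ?_).mono_set subset_closure
  simp only [dotProduct, Matrix.mulVec]
  refine continuousOn_finsetSum _ fun i _ => ContinuousOn.mul ?_ (hg i).continuousOn
  exact continuousOn_finsetSum _ fun j _ => (hγ.1 i j).mul (hg j).continuousOn

/-- Dividing an integrable function by `(1 + ε v)²` does not change its integral in the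
limit `ε → 0`, for bounded `v`. -/
theorem tendsto_integral_div_one_add_mul_sq {X : Type*} [MeasurableSpace X] {μ : Measure X}
    {q v : X → ℝ} {M : ℝ} (hq : Integrable q μ) (hvm : AEStronglyMeasurable v μ)
    (hv : ∀ x, |v x| ≤ M) :
    Tendsto (fun ε : ℝ => ∫ x, q x / (1 + ε * v x) ^ 2 ∂μ) (𝓝 0) (𝓝 (∫ x, q x ∂μ)) := by
  have hpos := eventually_forall_mul_of_bounded hv (P := fun t => -(1 / 2) < t)
    (lt_mem_nhds (by norm_num))
  refine tendsto_integral_filter_of_dominated_convergence (fun x => 4 * ‖q x‖) ?_ ?_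
    (hq.norm.const_mul 4) ?_
  · filter_upwards with ε
    exact (hq.aestronglyMeasurable.aemeasurable.div
      (((hvm.aemeasurable.const_mul ε).const_add 1).pow_const 2)).aestronglyMeasurable
  · filter_upwards [hpos] with ε hε
    refine .of_forall fun x => ?_
    have h := hε x
    have h4 : 1 / 4 ≤ (1 + ε * v x) ^ 2 := by nlinarith
    rw [norm_div, Real.norm_of_nonneg (sq_nonneg (1 + ε * v x)), div_le_iff₀ (by linarith)]
    nlinarith [norm_nonneg (q x)]
  · refine .of_forall fun x => ?_
    have h : ContinuousAt (fun ε : ℝ => q x / (1 + ε * v x) ^ 2) 0 :=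
      ContinuousAt.div (by fun_prop) (by fun_prop) (by simp)
    simpa using h.tendsto

/-- With `c_ε = (1 + εu)^α` and
`λ_ε = (∫ (γ∇c_ε)·∇c_ε/c_ε²) / (∫ (c_ε^{−2} − 1))`, the denominator is nonzero for all
sufficiently small `ε > 0`, and `λ_ε → (α/(2α+1)) ∫ (γ∇u)·∇u` as `ε → 0⁺`. -/
theorem asymptotic_frequency
    {n : ℕ} (hn : 3 ≤ n) (Ω : Set (Fin n → ℝ)) (hΩo : IsOpen Ω)
    (hΩb : Bornology.IsBounded Ω)
    (γ : (Fin n → ℝ) → Matrix (Fin n) (Fin n) ℝ)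
    (hγ : IsConductivityOn γ (closure Ω))
    (u : (Fin n → ℝ) → ℝ) (hune : u ≠ 0) (hu : ContDiff ℝ (⊤ : ℕ∞) u)
    (husupp : HasCompactSupport u) (husub : tsupport u ⊆ Ω)
    (hu0 : (∫ x in Ω, u x) = 0) (hu2 : (∫ x in Ω, (u x) ^ 2) = 1)
    (α : ℝ) (hα : 0 < α) :
    (∀ᶠ ε in 𝓝[>] (0 : ℝ),
      (∫ x in Ω, (((1 + ε * u x) ^ α) ^ (-2 : ℤ) - 1)) ≠ 0) ∧
    Filter.Tendsto
      (fun ε : ℝ =>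
        (∫ x in Ω,
          ((γ x).mulVec (grad (fun y => (1 + ε * u y) ^ α) x)
              ⬝ᵥ grad (fun y => (1 + ε * u y) ^ α) x)
            / ((1 + ε * u x) ^ α) ^ 2)
        / (∫ x in Ω, (((1 + ε * u x) ^ α) ^ (-2 : ℤ) - 1)))
      (𝓝[>] 0)
      (𝓝 ((α / (2 * α + 1)) * ∫ x in Ω, (γ x).mulVec (grad u x) ⬝ᵥ grad u x)) := by
  obtain ⟨M, hM⟩ := hu.continuous.bounded_above_of_compact_support husupp
  have huM : ∀ x, |u x| ≤ M := hM
  have : IsFiniteMeasure (volume.restrict Ω) := ⟨by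
    rw [Measure.restrict_apply_univ]; exact hΩb.measure_lt_top⟩
  have hpos : ∀ᶠ ε in 𝓝[>] (0 : ℝ), ∀ x, -1 < ε * u x :=
    nhdsWithin_le_nhds (eventually_forall_mul_of_bounded huM (lt_mem_nhds (by norm_num)))
  have hden : Tendsto
      (fun ε : ℝ => (∫ x in Ω, (((1 + ε * u x) ^ α) ^ (-2 : ℤ) - 1)) / ε ^ 2) (𝓝[>] 0)
      (𝓝 (α * (2 * α + 1))) := by
    have h := (tendsto_integral_one_add_rpow_sub_one_div_sq hu.continuous huM hu0
      (-2 * α)).mono_left (nhdsWithin_mono (0 : ℝ) fun ε (hε : 0 < ε) => hε.ne')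
    rw [hu2, show -2 * α * (-2 * α - 1) / 2 * 1 = α * (2 * α + 1) by ring] at h
    refine h.congr' ?_
    filter_upwards [hpos] with ε hε
    congr 2
    ext x
    have hx : 0 ≤ 1 + ε * u x := by linarith [hε x]
    rw [← Real.rpow_intCast, ← Real.rpow_mul hx]
    congr 2
    push_cast
    ring
  have hlim : α * (2 * α + 1) ≠ 0 := by positivity
  refine ⟨?_, ?_⟩
  · filter_upwards [hden.eventually_ne hlim] with ε hε h
    exact hε (by rw [h, zero_div])
  have hnum : Tendsto (fun ε : ℝ => α ^ 2 *
      ∫ x in Ω, ((γ x).mulVec (grad u x) ⬝ᵥ grad u x) / (1 + ε * u x) ^ 2) (𝓝[>] 0)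
      (𝓝 (α ^ 2 * ∫ x in Ω, (γ x).mulVec (grad u x) ⬝ᵥ grad u x)) :=
    ((tendsto_integral_div_one_add_mul_sq
      (integrableOn_energy hΩb hγ (hu.of_le (by exact_mod_cast le_top)))
      hu.continuous.aestronglyMeasurable huM).mono_left nhdsWithin_le_nhds).const_mul _
  have hquot := hnum.div hden hlim
  rw [show (α ^ 2 * ∫ x in Ω, (γ x).mulVec (grad u x) ⬝ᵥ grad u x) / (α * (2 * α + 1)) =
    α / (2 * α + 1) * ∫ x in Ω, (γ x).mulVec (grad u x) ⬝ᵥ grad u x by field_simp] at hquot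
  refine hquot.congr' ?_
  filter_upwards [hpos, self_mem_nhdsWithin] with ε hε hε0
  have hne : ε ^ 2 ≠ 0 := pow_ne_zero 2 (ne_of_gt hε0)
  have hdiff : Differentiable ℝ u := hu.differentiable (by simp)
  have henergy := integral_congr_ae (μ := volume.restrict Ω) (.of_forall fun x =>
    energy_one_add_mul_rpow (γ x) (hdiff x) α (show 0 < 1 + ε * u x by linarith [hε x]))
  rw [henergy, integral_const_mul, Pi.div_apply, div_div_eq_mul_div]
  ring
end
end
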